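/- arXiv:1811.04410 — 2 statements merged into one kernel-verified Lean document; each statement's English description precedes it below -/
import Mathlib

section
/- Suppose condition (C1) holds. Then there exists a constant B > 0 such that for every λ > 0 the self-similar profile f_λ satisfies lim_{r→∞} r^{γ} ( (r²/C_*)^{1/(1-m)} f_λ(r) − 1 ) = − B λ^{−γ}, where γ = γ_1(m,β); equivalently, f_λ(r) = (C_*/r²)^{1/(1-m)} { 1 − B λ^{−γ} r^{−γ} + o(r^{−γ}) } as r → ∞. -/
open Real Filter MeasureTheory Set Topology

noncomputable section

def Cstar (n : ℕ) (m : ℝ) : ℝ := 2 * m * ((n : ℝ) - 2 - n * m) / (1 - m)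

def beta1 (n : ℕ) (m : ℝ) : ℝ := 1 / ((n : ℝ) - 2 - n * m)

def betaE (n : ℕ) (m : ℝ) : ℝ := m / ((n : ℝ) - 2 - n * m)

def beta2 (n : ℕ) (m : ℝ) : ℝ :=
  Real.sqrt (2 * (1 - m) / ((n : ℝ) - 2 - n * m)) +
    (((n : ℝ) + 2) * m - ((n : ℝ) - 2)) / (2 * ((n : ℝ) - 2 - n * m))

def beta0 (n : ℕ) (m : ℝ) : ℝ := max (beta2 n m) (betaE n m)

def A0 (n : ℕ) (m β : ℝ) : ℝ :=
  (n : ℝ) - 2 - ((n : ℝ) + 2) * m + 2 * β * ((n : ℝ) - 2 - n * m)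

def gamma1 (n : ℕ) (m β : ℝ) : ℝ :=
  (A0 n m β - Real.sqrt ((A0 n m β) ^ 2 - 8 * ((n : ℝ) - 2 - n * m) * (1 - m))) / (2 * (1 - m))

def gamma2 (n : ℕ) (m β : ℝ) : ℝ :=
  (A0 n m β + Real.sqrt ((A0 n m β) ^ 2 - 8 * ((n : ℝ) - 2 - n * m) * (1 - m))) / (2 * (1 - m))

def Acoef1 (n : ℕ) (m β : ℝ) : ℝ := 1 / (1 - m) - β * gamma1 n m β

def Acoef2 (n : ℕ) (m β : ℝ) : ℝ := 1 / (1 - m) - β * gamma2 n m β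

/-- Condition (C1). -/
def CondC1 (n : ℕ) (m β : ℝ) : Prop :=
  beta1 n m < β ∨
    (4 < n ∧ 0 < m ∧ m < ((n : ℝ) - 4) / ((n : ℝ) - 2) ∧ beta0 n m < β ∧ β ≤ beta1 n m)

/-- Condition (C2). -/
def CondC2 (n : ℕ) (m β : ℝ) : Prop :=
  beta0 n m < β ∧ β < beta1 n m ∧
    (n ≤ 4 ∨ (4 < n ∧ ((n : ℝ) - 4) / ((n : ℝ) - 2) < m ∧ m < ((n : ℝ) - 2) / n))

/-- Condition (C3). -/
def CondC3 (n : ℕ) (m β : ℝ) : Prop :=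
  β = beta1 n m ∧
    (n ≤ 4 ∨ (4 < n ∧ ((n : ℝ) - 4) / ((n : ℝ) - 2) < m ∧ m < ((n : ℝ) - 2) / n))

/-- A self-similar profile `f = f_lam`. -/
structure IsProfile (n : ℕ) (m β α lam : ℝ) (f : ℝ → ℝ) : Prop where
  pos : ∀ r, 0 ≤ r → 0 < f r
  smooth : ContDiffOn ℝ 2 f (Set.Ici 0)
  ode : ∀ r, 0 < r →
    deriv (deriv (fun s => f s ^ m)) r + (((n : ℝ) - 1) / r) * deriv (fun s => f s ^ m) r +
      α * f r + β * r * deriv f r = 0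
  init : f 0 = lam ^ (2 / (1 - m))
  init' : deriv f 0 = 0
  asymp : Tendsto (fun r => r ^ 2 * f r ^ (1 - m)) atTop (nhds (Cstar n m))

/-- The Laplacian of `f : ℝ^n → ℝ`. -/
def lap (n : ℕ) (f : EuclideanSpace ℝ (Fin n) → ℝ) (x : EuclideanSpace ℝ (Fin n)) : ℝ :=
  ∑ i : Fin n,
    fderiv ℝ (fun y => fderiv ℝ f y (EuclideanSpace.single i (1 : ℝ))) x
      (EuclideanSpace.single i (1 : ℝ))

/-- The self-similar solution `U_lam(x,t) = (T-t)^α f_lam((T-t)^β |x|)`. -/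
def Uself (n : ℕ) (β α T : ℝ) (f : ℝ → ℝ) (x : EuclideanSpace ℝ (Fin n)) (t : ℝ) : ℝ :=
  (T - t) ^ α * f ((T - t) ^ β * ‖x‖)

/-- A (positive smooth) solution of the Cauchy problem `u_t = Δ(u^m)` on `ℝ^n × (0,T)` with
initial value `u0` taken in `L¹_loc`. -/
structure IsCauchySolution (n : ℕ) (m T : ℝ) (u0 : EuclideanSpace ℝ (Fin n) → ℝ)
    (u : EuclideanSpace ℝ (Fin n) → ℝ → ℝ) : Prop where
  pos : ∀ x, ∀ t ∈ Set.Ioo 0 T, 0 < u x t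
  smooth : ContDiffOn ℝ (⊤ : ℕ∞) (fun p : EuclideanSpace ℝ (Fin n) × ℝ => u p.1 p.2)
    ((Set.univ : Set (EuclideanSpace ℝ (Fin n))) ×ˢ Set.Ioo 0 T)
  pde : ∀ x, ∀ t ∈ Set.Ioo 0 T, deriv (u x) t = lap n (fun y => u y t ^ m) x
  init : ∀ K : Set (EuclideanSpace ℝ (Fin n)), IsCompact K →
    Tendsto (fun t => ∫ x in K, |u x t - u0 x|) (nhdsWithin 0 (Set.Ioi 0)) (nhds 0)

/-- The rescaled solution `ũ(y,τ)`. -/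
def resc (n : ℕ) (β α T : ℝ) (u : EuclideanSpace ℝ (Fin n) → ℝ → ℝ)
    (y : EuclideanSpace ℝ (Fin n)) (τ : ℝ) : ℝ :=
  (T * Real.exp (-τ)) ^ (-α) * u (((T * Real.exp (-τ)) ^ (-β)) • y) (T * (1 - Real.exp (-τ)))

/-- The singular profile `𝒞(y) = (C_*/|y|²)^{1/(1-m)}`. -/
def singC (n : ℕ) (m : ℝ) (y : EuclideanSpace ℝ (Fin n)) : ℝ :=
  (Cstar n m / ‖y‖ ^ 2) ^ (1 / (1 - m))

/-- The weight exponent `p₀`. -/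
def pZero (n : ℕ) (m β : ℝ) : ℝ := ((1 - m) / 2) * ((n : ℝ) - 2 / (1 - m) - gamma1 n m β)

/-- The constant `a_*`. -/
def aStar (n : ℕ) (m β : ℝ) : ℝ :=
  2 * m * pZero n m β / (Cstar n m * (1 - m)) * (gamma1 n m β + 2 * m / (1 - m))

/-- `Φ(s) = (1+w(s))^{1/m} − 1 − w(s)/m`. -/
def Phi (m : ℝ) (w : ℝ → ℝ) (s : ℝ) : ℝ := (1 + w s) ^ (1 / m) - 1 - w s / m

end

/-- A function with nonpositive derivative on a ray is antitone there. -/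
theorem antitoneOn_Ici_of_hasDerivAt {f f' : ℝ → ℝ} {S : ℝ}
    (hf : ∀ s, S ≤ s → HasDerivAt f (f' s) s) (hf' : ∀ s, S ≤ s → f' s ≤ 0) :
    AntitoneOn f (Ici S) := by
  refine antitoneOn_of_deriv_nonpos (convex_Ici S)
    (fun s hs => (hf s hs).continuousAt.continuousWithinAt)
    (fun s hs => (hf s (interior_subset hs)).differentiableAt.differentiableWithinAt) ?_
  intro s hs
  rw [(hf s (interior_subset hs)).deriv]
  exact hf' s (interior_subset hs)

/-- Exponential Gronwall inequality on a ray. -/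
theorem le_exp_mul_of_hasDerivAt_le {f f' : ℝ → ℝ} {S η : ℝ}
    (hf : ∀ s, S ≤ s → HasDerivAt f (f' s) s) (hf' : ∀ s, S ≤ s → f' s ≤ η * f s)
    {s : ℝ} (hs : S ≤ s) : f s ≤ f S * exp (-(η * S)) * exp (η * s) := by
  have hd : ∀ t, S ≤ t → HasDerivAt (fun t => exp (-(η * t)) * f t)
      (exp (-(η * t)) * (f' t - η * f t)) t := by
    intro t ht
    have h1 : HasDerivAt (fun t : ℝ => -(η * t)) (-(η * 1)) t :=
      ((hasDerivAt_id t).const_mul η).neg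
    exact (h1.exp.mul (hf t ht)).congr_deriv (by ring)
  have hA := antitoneOn_Ici_of_hasDerivAt hd (fun t ht =>
    mul_nonpos_of_nonneg_of_nonpos (exp_pos _).le (by linarith [hf' t ht]))
  have h := mul_le_mul_of_nonneg_right (hA self_mem_Ici hs hs) (exp_pos (η * s)).le
  have he : exp (-(η * s)) * exp (η * s) = 1 := by rw [← exp_add]; simp
  calc f s = exp (-(η * s)) * f s * exp (η * s) := by linear_combination -(f s) * he
    _ ≤ _ := h
    _ = _ := by ring

theorem tendsto_exp_mul_atTop_of_neg {a : ℝ} (ha : a < 0) :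
    Tendsto (fun s => exp (a * s)) atTop (𝓝 0) :=
  tendsto_exp_atBot.comp (tendsto_id.const_mul_atTop_of_neg ha)

theorem tendsto_exp_mul_atBot_of_pos {a : ℝ} (ha : 0 < a) :
    Tendsto (fun s => exp (a * s)) atBot (𝓝 0) :=
  tendsto_exp_atBot.comp (tendsto_id.const_mul_atBot ha)

theorem eventually_lt_of_hasDerivAt_le {U U' : ℝ → ℝ} {S δ c d : ℝ} (hδ : 0 < δ) (hcd : c < d)
    (hU : ∀ s, S ≤ s → HasDerivAt U (U' s) s) (hU' : ∀ s, S ≤ s → U' s ≤ δ * (c - U s)) :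
    ∀ᶠ s in atTop, U s < d := by
  have h : ∀ s, S ≤ s → U s - c ≤ (U S - c) * exp (-(-δ * S)) * exp (-δ * s) := fun s hs =>
    le_exp_mul_of_hasDerivAt_le (f := fun s => U s - c) (η := -δ)
      (fun t ht => (hU t ht).sub_const c) (fun t ht => by linarith [hU' t ht]) hs
  have hlim : Tendsto (fun s => (U S - c) * exp (-(-δ * S)) * exp (-δ * s)) atTop (𝓝 0) := by
    simpa using (tendsto_exp_mul_atTop_of_neg (neg_neg_of_pos hδ)).const_mul ((U S - c) * exp (-(-δ * S)))
  filter_upwards [eventually_ge_atTop S, hlim.eventually_lt_const (sub_pos.2 hcd)] with s hs hs'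
  linarith [h s hs]

/-- A stable scalar linear equation with convergent forcing has convergent solutions. -/
theorem tendsto_of_hasDerivAt_linear {U h : ℝ → ℝ} {δ K : ℝ} (hδ : 0 < δ)
    (hU : ∀ s, HasDerivAt U (h s - δ * U s) s) (hh : Tendsto h atTop (𝓝 K)) :
    Tendsto U atTop (𝓝 (K / δ)) := by
  refine tendsto_order.2 ⟨fun a ha => ?_, fun a ha => ?_⟩
  · obtain ⟨c, hac, hcK⟩ := exists_between ha
    have hc : δ * c < K := by rw [lt_div_iff₀ hδ] at hcK; linarith
    obtain ⟨S, hS⟩ := eventually_atTop.1 (hh.eventually_const_lt hc)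
    have := eventually_lt_of_hasDerivAt_le (U := fun s => -U s) (S := S) hδ (neg_lt_neg hac)
      (fun s _ => (hU s).neg) (fun s hs => by linarith [hS s hs])
    filter_upwards [this] with s hs
    linarith
  · obtain ⟨c, hKc, hca⟩ := exists_between ha
    have hc : K < δ * c := by rw [div_lt_iff₀ hδ] at hKc; linarith
    obtain ⟨S, hS⟩ := eventually_atTop.1 (hh.eventually_lt_const hc)
    exact eventually_lt_of_hasDerivAt_le (S := S) hδ hca
      (fun s _ => hU s) (fun s hs => by linarith [hS s hs])

/-- Asymptotics of a triangular linear system perturbed by a quadratically small term `φ`. -/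
theorem tendsto_of_quadratic_perturbation {U G φ : ℝ → ℝ} {γ δ b κ p : ℝ}
    (hγ : 0 < γ) (hδ : 0 < δ) (hb : 0 ≤ b) (hκ : 0 ≤ κ)
    (hU0 : ∀ s, 0 ≤ U s) (hG0 : ∀ s, 0 ≤ G s) (hφ0 : ∀ s, 0 ≤ φ s)
    (hU : ∀ s, HasDerivAt U (G s - δ * U s + b * φ s) s)
    (hG : ∀ s, HasDerivAt G (κ * φ s) s)
    (hφ : ∀ s, φ s ≤ p * (exp (-γ * s) * U s ^ 2))
    (hsmall : Tendsto (fun s => exp (-γ * s) * U s) atTop (𝓝 0)) :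
    ∃ K, Tendsto G atTop (𝓝 K) ∧ Tendsto U atTop (𝓝 (K / δ)) ∧ Tendsto φ atTop (𝓝 0) := by
  obtain ⟨η, hη, hηγ⟩ : ∃ η : ℝ, 0 < η ∧ γ = 4 * η := ⟨γ / 4, by positivity, by ring⟩
  have hsm : ∀ᶠ s in atTop, (κ + η * b) * (p * (exp (-γ * s) * U s)) < η * δ := by
    refine Tendsto.eventually_lt_const (v := 0) (by positivity) ?_
    simpa using (hsmall.const_mul p).const_mul (κ + η * b)
  obtain ⟨S, hS⟩ := eventually_atTop.1 hsm
  have hL : ∀ s, S ≤ s → G s + η * U s ≤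
      (G S + η * U S) * exp (-(η * S)) * exp (η * s) := by
    intro s hs
    refine le_exp_mul_of_hasDerivAt_le (f := fun s => G s + η * U s)
      (fun t _ => (hG t).add ((hU t).const_mul η)) (fun t ht => ?_) hs
    have h1 : (κ + η * b) * φ t ≤ (κ + η * b) * (p * (exp (-γ * t) * U t)) * U t := by
      have := mul_le_mul_of_nonneg_left (hφ t) (by positivity : 0 ≤ κ + η * b)
      linarith
    have h2 := mul_le_mul_of_nonneg_right (hS t ht).le (hU0 t)
    have h3 := mul_nonneg (mul_nonneg hη.le hη.le) (hU0 t)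
    nlinarith
  set M := (G S + η * U S) * exp (-(η * S)) with hM
  set C := |p| * (M / η) ^ 2 with hC
  have hC0 : 0 ≤ C := by positivity
  have hφC : ∀ s, S ≤ s → φ s ≤ C * exp (-(2 * η) * s) := by
    intro s hs
    have hUM : U s ≤ M / η * exp (η * s) := by
      rw [div_mul_eq_mul_div, le_div_iff₀ hη]
      linarith [hL s hs, hG0 s]
    have hU2 : U s ^ 2 ≤ (M / η * exp (η * s)) ^ 2 := pow_le_pow_left₀ (hU0 s) hUM 2
    have he : exp (-γ * s) * exp (η * s) ^ 2 = exp (-(2 * η) * s) := by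
      rw [← exp_nat_mul, ← exp_add, hηγ]; congr 1; push_cast; ring
    calc φ s ≤ p * (exp (-γ * s) * U s ^ 2) := hφ s
      _ ≤ |p| * (exp (-γ * s) * U s ^ 2) := by gcongr; exact le_abs_self p
      _ ≤ |p| * (exp (-γ * s) * (M / η * exp (η * s)) ^ 2) := by gcongr
      _ = C * exp (-(2 * η) * s) := by rw [← he, hC]; ring
  have hφlim : Tendsto φ atTop (𝓝 0) := by
    have := (tendsto_exp_mul_atTop_of_neg (a := -(2 * η)) (by linarith)).const_mul C
    rw [mul_zero] at this
    exact tendsto_of_tendsto_of_tendsto_of_le_of_le' tendsto_const_nhds this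
      (Eventually.of_forall hφ0) (eventually_atTop.2 ⟨S, hφC⟩)
  have hmono : Monotone G := monotone_of_deriv_nonneg (fun s => (hG s).differentiableAt)
    (fun s => by rw [(hG s).deriv]; exact mul_nonneg hκ (hφ0 s))
  have hbdd : BddAbove (range G) := by
    have hd : ∀ s, S ≤ s → HasDerivAt (fun s => G s + κ * C / (2 * η) * exp (-(2 * η) * s))
        (κ * φ s - κ * (C * exp (-(2 * η) * s))) s := by
      intro s _
      have h1 : HasDerivAt (fun s : ℝ => -(2 * η) * s) (-(2 * η) * 1) s :=
        (hasDerivAt_id s).const_mul _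
      refine ((hG s).add (h1.exp.const_mul (κ * C / (2 * η)))).congr_deriv ?_
      field_simp
      ring
    have hA := antitoneOn_Ici_of_hasDerivAt hd (fun s hs => by
      have := mul_le_mul_of_nonneg_left (hφC s hs) hκ
      linarith)
    refine ⟨G S + κ * C / (2 * η) * exp (-(2 * η) * S), ?_⟩
    rintro _ ⟨s, rfl⟩
    have h1 := hA self_mem_Ici (le_max_left S s : S ≤ max S s) (le_max_left S s)
    have h2 : 0 ≤ κ * C / (2 * η) * exp (-(2 * η) * max S s) := by positivity
    have h3 := hmono (le_max_right S s)
    simp only at h1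
    linarith
  have hGK := tendsto_atTop_ciSup hmono hbdd
  refine ⟨_, hGK, ?_, hφlim⟩
  refine tendsto_of_hasDerivAt_linear hδ (h := fun s => G s + b * φ s)
    (fun s => (hU s).congr_deriv (by ring)) ?_
  simpa using hGK.add (hφlim.const_mul b)

theorem sub_one_sub_nonneg_of_rpow {m x : ℝ} (hm0 : 0 < m) (hm1 : m < 1) (hx : 0 < x) :
    0 ≤ x - 1 - (x ^ m - 1) / m := by
  have h := rpow_one_add_le_one_add_mul_self (s := x - 1) (by linarith) hm0.le hm1.le
  rw [add_sub_cancel] at h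
  rw [sub_nonneg, div_le_iff₀ hm0]
  linarith

theorem sub_one_sub_le_sq_of_rpow {m x : ℝ} (hm0 : 0 < m) (hm1 : m < 1) (hx : 0 < x)
    (hx1 : x ^ m ≤ 1) : x - 1 - (x ^ m - 1) / m ≤ (1 / m) ^ 2 * (1 - x ^ m) ^ 2 := by
  set y := x ^ m with hy
  have hy0 : 0 < y := rpow_pos_of_pos hx m
  have hp1 : 1 ≤ 1 / m := (one_le_div hm0).2 hm1.le
  have hxy : x = y ^ (1 / m) := by
    rw [hy, ← rpow_mul hx.le, mul_one_div_cancel hm0.ne', rpow_one]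
  have hB := one_add_mul_self_le_rpow_one_add (s := 1 - y) (by linarith) hp1
  set p := 1 / m with hp
  have hprod : x * (1 + (1 - y)) ^ p ≤ 1 := by
    rw [hxy, ← mul_rpow hy0.le (by linarith)]
    exact rpow_le_one (by nlinarith) (by nlinarith [sq_nonneg (y - 1)]) (by linarith)
  have h1 : x * (1 + p * (1 - y)) ≤ 1 := (mul_le_mul_of_nonneg_left hB hx.le).trans hprod
  have h2 : (y - 1) / m = -(p * (1 - y)) := by rw [hp]; ring
  rw [h2]
  set q := p * (1 - y) with hq
  have hq0 : 0 ≤ q := mul_nonneg (by linarith) (by linarith)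
  have hq2 : p ^ 2 * (1 - y) ^ 2 = q ^ 2 := by rw [hq]; ring
  rw [hq2]
  have h3 : (x - 1 + q) * (1 + q) ≤ q ^ 2 * (1 + q) := by nlinarith [pow_nonneg hq0 3]
  have := le_of_mul_le_mul_right h3 (by linarith)
  linarith

/-- Slow-mode asymptotics of a heteroclinic orbit of the logarithmic profile equation, written
through the first-order quantity
`exp (γ₁ s) * (V' + γ₂ (V - 1) + b (v - 1 - (V - 1) / m))`, where `V = v ^ m`. -/
theorem exists_tendsto_exp_mul_sub_one {v V V' : ℝ → ℝ} {γ₁ γ₂ m b κ : ℝ}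
    (hm0 : 0 < m) (hm1 : m < 1) (hγ₁ : 0 < γ₁) (hγ : γ₁ < γ₂) (hb : 0 ≤ b) (hκ : 0 < κ)
    (hv : ∀ s, 0 < v s) (hVv : ∀ s, V s = v s ^ m) (hV : ∀ s, HasDerivAt V (V' s) s)
    (hE : ∀ s, HasDerivAt
      (fun s => exp (γ₁ * s) * (V' s + γ₂ * (V s - 1) + b * (v s - 1 - (V s - 1) / m)))
      (-(κ * (exp (γ₁ * s) * (v s - 1 - (V s - 1) / m)))) s)
    (hv_bot : Tendsto v atBot (𝓝 0)) (hV'_bot : Tendsto V' atBot (𝓝 0))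
    (hv_top : Tendsto v atTop (𝓝 1)) :
    ∃ B : ℝ, 0 < B ∧ Tendsto (fun s => exp (γ₁ * s) * (v s - 1)) atTop (𝓝 (-B)) := by
  set Φ : ℝ → ℝ := fun s => v s - 1 - (V s - 1) / m with hΦ
  set G : ℝ → ℝ := fun s => -(exp (γ₁ * s) * (V' s + γ₂ * (V s - 1) + b * Φ s)) with hGdef
  have hV_bot : Tendsto V atBot (𝓝 0) := by
    have := hv_bot.rpow_const (p := m) (Or.inr hm0.le)
    rw [zero_rpow hm0.ne'] at this
    exact this.congr fun s => (hVv s).symm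
  have hV_top : Tendsto V atTop (𝓝 1) := by
    have := hv_top.rpow_const (p := m) (Or.inr hm0.le)
    rw [one_rpow] at this
    exact this.congr fun s => (hVv s).symm
  have hΦ_bot : Tendsto Φ atBot (𝓝 (0 - 1 - (0 - 1) / m)) :=
    (hv_bot.sub_const 1).sub ((hV_bot.sub_const 1).div_const m)
  have hΦ0 : ∀ s, 0 ≤ Φ s := fun s => by
    simp only [hΦ, hVv]
    exact sub_one_sub_nonneg_of_rpow hm0 hm1 (hv s)
  have hG : ∀ s, HasDerivAt G (κ * (exp (γ₁ * s) * Φ s)) s := fun s =>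
    (hE s).neg.congr_deriv (neg_neg _)
  have hG_bot : Tendsto G atBot (𝓝 0) := by
    have h1 := (tendsto_exp_mul_atBot_of_pos hγ₁).mul
      ((hV'_bot.add ((hV_bot.sub_const 1).const_mul γ₂)).add (hΦ_bot.const_mul b))
    rw [zero_mul] at h1
    simpa using h1.neg
  have hGmono : Monotone G := monotone_of_deriv_nonneg (fun s => (hG s).differentiableAt)
    (fun s => by
      rw [(hG s).deriv]
      exact mul_nonneg hκ.le (mul_nonneg (exp_pos _).le (hΦ0 s)))
  have hG0 : ∀ s, 0 ≤ G s := fun s => hGmono.le_of_tendsto hG_bot s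
  have hGpos : ∃ s, 0 < G s := by
    have hpos : (0 : ℝ) < 0 - 1 - (0 - 1) / m := by
      have : 1 < 1 / m := (one_lt_div hm0).2 hm1
      have h2 : (0 - 1) / m = -(1 / m) := by ring
      rw [h2]; linarith
    obtain ⟨S, hS⟩ := eventually_atBot.1 (hΦ_bot.eventually_const_lt hpos)
    have hstrict : StrictMonoOn G (Iic S) := by
      refine strictMonoOn_of_deriv_pos (convex_Iic S)
        (fun s _ => (hG s).continuousAt.continuousWithinAt) fun s hs => ?_
      rw [(hG s).deriv]
      exact mul_pos hκ (mul_pos (exp_pos _) (hS s (le_of_lt (by simpa using hs))))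
    exact ⟨S, (hG0 (S - 1)).trans_lt
      (hstrict (by simp : S - 1 ≤ S) (by simp : S ≤ S) (by linarith))⟩
  have hV1 : ∀ s, V s ≤ 1 := by
    have hd : ∀ s, HasDerivAt (fun s => exp (γ₂ * s) * (1 - V s))
        (exp (γ₂ * s) * (exp (-γ₁ * s) * G s + b * Φ s)) s := by
      intro s
      have h1 : HasDerivAt (fun s : ℝ => γ₂ * s) (γ₂ * 1) s := (hasDerivAt_id s).const_mul _
      have he : exp (-γ₁ * s) * exp (γ₁ * s) = 1 := by rw [← exp_add]; simp
      refine (h1.exp.mul ((hV s).const_sub 1)).congr_deriv ?_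
      simp only [hGdef]
      linear_combination
        (exp (γ₂ * s) * (V' s + γ₂ * (V s - 1) + b * Φ s)) * he
    have hmono := monotone_of_deriv_nonneg (fun s => (hd s).differentiableAt) (fun s => by
      rw [(hd s).deriv]
      have := hΦ0 s
      have := hG0 s
      positivity)
    have hlim : Tendsto (fun s => exp (γ₂ * s) * (1 - V s)) atBot (𝓝 0) := by
      simpa using (tendsto_exp_mul_atBot_of_pos (hγ₁.trans hγ)).mul (hV_bot.const_sub 1)
    intro s
    have h := hmono.le_of_tendsto hlim s
    have := nonneg_of_mul_nonneg_right h (exp_pos _)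
    linarith
  have hδ : 0 < γ₂ - γ₁ := sub_pos.2 hγ
  have hcancel : ∀ s, exp (-γ₁ * s) * exp (γ₁ * s) = 1 := fun s => by rw [← exp_add]; simp
  obtain ⟨K, hGK, hUK, hφ⟩ := tendsto_of_quadratic_perturbation
    (U := fun s => exp (γ₁ * s) * (1 - V s)) (G := G) (φ := fun s => exp (γ₁ * s) * Φ s)
    (γ := γ₁) (δ := γ₂ - γ₁) (b := b) (κ := κ) (p := (1 / m) ^ 2) hγ₁ hδ hb hκ.le
    (fun s => mul_nonneg (exp_pos _).le (sub_nonneg.2 (hV1 s))) hG0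
    (fun s => mul_nonneg (exp_pos _).le (hΦ0 s))
    (fun s => by
      have h1 : HasDerivAt (fun s : ℝ => γ₁ * s) (γ₁ * 1) s := (hasDerivAt_id s).const_mul _
      refine (h1.exp.mul ((hV s).const_sub 1)).congr_deriv ?_
      simp only [hGdef]
      ring)
    hG
    (fun s => by
      have h := sub_one_sub_le_sq_of_rpow hm0 hm1 (hv s) (by rw [← hVv]; exact hV1 s)
      rw [← hVv] at h
      have h' := mul_le_mul_of_nonneg_left h (exp_pos (γ₁ * s)).le
      calc _ ≤ _ := h'
        _ = _ := by
          linear_combination -(exp (γ₁ * s) * ((1 / m) ^ 2 * (1 - V s) ^ 2)) * hcancel s)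
    (by
      have h : Tendsto (fun s => 1 - V s) atTop (𝓝 0) := by
        simpa using hV_top.const_sub 1
      refine h.congr fun s => ?_
      linear_combination -(1 - V s) * hcancel s)
  have hK : 0 < K := by
    obtain ⟨s, hs⟩ := hGpos
    exact hs.trans_le (hGmono.ge_of_tendsto hGK s)
  refine ⟨K / (γ₂ - γ₁) / m, by positivity, ?_⟩
  have h := hφ.sub (hUK.div_const m)
  rw [zero_sub] at h
  refine h.congr fun s => ?_
  simp only [hΦ]
  ring

theorem CondC1.gamma1_bounds {n : ℕ} {m β : ℝ} (hn : 3 ≤ n) (hm0 : 0 < m)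
    (hm1 : m < ((n : ℝ) - 2) / n) (h : CondC1 n m β) :
    0 < β ∧ m < 1 ∧ 0 < (n : ℝ) - 2 - n * m ∧ 0 < gamma1 n m β ∧
      gamma1 n m β < gamma2 n m β ∧ β * gamma1 n m β < 1 / (1 - m) ∧
      gamma1 n m β + gamma2 n m β = A0 n m β / (1 - m) ∧
      gamma1 n m β * gamma2 n m β = 2 * ((n : ℝ) - 2 - n * m) / (1 - m) := by
  have hn' : (3 : ℝ) ≤ n := by exact_mod_cast hn
  have hn0 : (0 : ℝ) < n := by linarith
  have hN : 0 < (n : ℝ) - 2 - n * m := by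
    rw [lt_div_iff₀ hn0] at hm1; linarith
  have hm : m < 1 := hm1.trans ((div_lt_one hn0).2 (by linarith))
  have hm' : 0 < 1 - m := by linarith
  obtain ⟨N, hNdef⟩ : ∃ N, N = (n : ℝ) - 2 - n * m := ⟨_, rfl⟩
  have hA : A0 n m β = N - 2 * m + 2 * β * N := by rw [A0, hNdef]; ring
  unfold gamma1 gamma2
  rw [hA, ← hNdef]
  rw [← hNdef] at hN
  set A := N - 2 * m + 2 * β * N with hAdef
  have hfact : 1 - A * β + 2 * N * (1 - m) * β ^ 2 =
      (1 - N * β) * (1 + 2 * m * β) := by rw [hAdef]; ring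
  -- it suffices to bound `A`, its discriminant and `β`
  have key : 0 < β ∧ 0 < A ∧ 0 < A ^ 2 - 8 * N * (1 - m) ∧
      (A * β < 2 ∨ A * β - 1 - 2 * N * (1 - m) * β ^ 2 > 0) := by
    rcases h with h | ⟨hn4, -, hm4, hβ, hβ1⟩
    · rw [beta1, ← hNdef] at h
      have hβ : 0 < β := lt_trans (by positivity) h
      have hNβ : 1 < N * β := by rw [div_lt_iff₀ hN] at h; linarith
      have hq : 0 < A * β - 1 - 2 * N * (1 - m) * β ^ 2 := by
        have : 0 < (N * β - 1) * (1 + 2 * m * β) :=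
          mul_pos (by linarith) (by positivity)
        linarith
      refine ⟨hβ, by rw [hAdef]; nlinarith, ?_, Or.inr hq⟩
      have h2 : 0 < (A ^ 2 - 8 * N * (1 - m)) * β ^ 2 := by
        nlinarith [sq_nonneg (A * β - 2)]
      exact pos_of_mul_pos_left h2 (sq_nonneg β)
    · have hn4' : (4 : ℝ) < n := by exact_mod_cast hn4
      have hN2 : 2 * (1 - m) < N := by
        rw [lt_div_iff₀ (by linarith)] at hm4
        linarith
      have hβe : 0 < β := by
        refine lt_trans ?_ ((le_max_right _ _).trans_lt hβ)
        rw [betaE, ← hNdef]; positivity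
      have hβ2 : beta2 n m < β := (le_max_left _ _).trans_lt hβ
      rw [beta1, ← hNdef, le_div_iff₀ hN] at hβ1
      rw [beta2, ← hNdef] at hβ2
      set q := √(2 * (1 - m) / N) with hq
      have hq0 : 0 < q := Real.sqrt_pos.2 (by positivity)
      have hq2 : q ^ 2 * N = 2 * (1 - m) := by
        rw [hq, Real.sq_sqrt (by positivity)]; field_simp
      have hAq : 2 * N * q < A := by
        have h1 : (((n : ℝ) + 2) * m - ((n : ℝ) - 2)) / (2 * N) = -(N - 2 * m) / (2 * N) := by
          rw [hNdef]; ring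
        rw [h1] at hβ2
        have h2 := mul_lt_mul_of_pos_left hβ2 (by positivity : 0 < 2 * N)
        have h3 : 2 * N * (q + -(N - 2 * m) / (2 * N)) = 2 * N * q - (N - 2 * m) := by
          field_simp; ring
        rw [h3] at h2
        rw [hAdef]; linarith
      have hA0 : 0 < A := lt_trans (by positivity) hAq
      refine ⟨hβe, hA0, ?_, Or.inl ?_⟩
      · have h1 : (2 * N * q) ^ 2 < A ^ 2 := pow_lt_pow_left₀ hAq (by positivity) (by norm_num)
        have h2 : (2 * N * q) ^ 2 = 8 * N * (1 - m) := by linear_combination 4 * N * hq2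
        linarith
      · have h1 : A * β * N ≤ A * 1 := by
          rw [mul_assoc]; exact mul_le_mul_of_nonneg_left hβ1 hA0.le
        have h2 : A < 2 * N := by rw [hAdef]; linarith
        by_contra hcon
        push Not at hcon
        nlinarith
  obtain ⟨hβ, hA0, hD, hor⟩ := key
  set R := √(A ^ 2 - 8 * N * (1 - m)) with hR
  have hR0 : 0 < R := Real.sqrt_pos.2 hD
  have hR2 : R ^ 2 = A ^ 2 - 8 * N * (1 - m) := Real.sq_sqrt hD.le
  have hRA : R < A := by
    have h8 : 0 < 8 * N * (1 - m) := by positivity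
    nlinarith
  refine ⟨hβ, hm, hN, div_pos (by linarith) (by linarith), ?_, ?_, ?_, ?_⟩
  · gcongr; linarith
  · rw [mul_div_assoc', div_lt_div_iff₀ (by linarith) hm']
    have : β * (A - R) < 2 := by
      rcases hor with h1 | h1
      · nlinarith [mul_pos hβ hR0]
      · by_contra hcon
        push Not at hcon
        have h2 : β * R ≤ A * β - 2 := by linarith
        have h3 : (β * R) ^ 2 ≤ (A * β - 2) ^ 2 := pow_le_pow_left₀ (by positivity) h2 2
        nlinarith
    nlinarith
  · field_simp; ring
  · field_simp; linear_combination -hR2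

namespace IsProfile

variable {n : ℕ} {m β α lam : ℝ} {f : ℝ → ℝ}

theorem contDiffAt (h : IsProfile n m β α lam f) {r : ℝ} (hr : 0 < r) : ContDiffAt ℝ 2 f r :=
  h.smooth.contDiffAt (Ici_mem_nhds hr)

theorem hasDerivAt (h : IsProfile n m β α lam f) {r : ℝ} (hr : 0 < r) :
    HasDerivAt f (deriv f r) r :=
  ((h.contDiffAt hr).differentiableAt (by norm_num)).hasDerivAt

theorem hasDerivAt_rpow (h : IsProfile n m β α lam f) {r : ℝ} (hr : 0 < r) :
    HasDerivAt (fun s => f s ^ m) (deriv (fun s => f s ^ m) r) r :=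
  ((h.hasDerivAt hr).rpow_const (Or.inl (h.pos r hr.le).ne')).differentiableAt.hasDerivAt

theorem hasDerivAt_deriv_rpow (h : IsProfile n m β α lam f) {r : ℝ} (hr : 0 < r) :
    HasDerivAt (deriv fun s => f s ^ m) (deriv (deriv fun s => f s ^ m) r) r := by
  have hc : ContDiffAt ℝ 2 (fun s => f s ^ m) r :=
    (h.contDiffAt hr).rpow_const_of_ne (h.pos r hr.le).ne'
  exact ((hc.derivWithin (m := 1) (by norm_num)).differentiableAt (by norm_num)).hasDerivAt

theorem tendsto_nhdsGT_zero (h : IsProfile n m β α lam f) : Tendsto f (𝓝[>] 0) (𝓝 (f 0)) :=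
  (h.smooth.continuousOn 0 self_mem_Ici).mono_left (nhdsWithin_mono 0 Ioi_subset_Ici_self)

theorem exists_tendsto_deriv_nhdsGT_zero (h : IsProfile n m β α lam f) :
    ∃ d, Tendsto (deriv f) (𝓝[>] 0) (𝓝 d) := by
  refine ⟨derivWithin f (Ici 0) 0, ?_⟩
  have hc := (h.smooth.continuousOn_derivWithin (uniqueDiffOn_Ici 0) (by norm_num)) 0 self_mem_Ici
  refine (hc.mono_left (nhdsWithin_mono 0 Ioi_subset_Ici_self)).congr' ?_
  filter_upwards [self_mem_nhdsWithin] with r hr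
  exact derivWithin_of_mem_nhds (Ici_mem_nhds hr)

/-- Asymptotics of a profile in the logarithmic variable `s = log r`. -/
theorem exists_tendsto_exp (h : IsProfile n m β α lam f) (hn : 3 ≤ n) (hm0 : 0 < m)
    (hm1 : m < ((n : ℝ) - 2) / n) (hα : α = (2 * β + 1) / (1 - m)) (hC1 : CondC1 n m β) :
    ∃ B : ℝ, 0 < B ∧ Tendsto (fun s => exp (gamma1 n m β * s) *
      ((exp s ^ 2 / Cstar n m) ^ (1 / (1 - m)) * f (exp s) - 1)) atTop (𝓝 (-B)) := by
  obtain ⟨hβ, hm, hN, hγ₁, hγ, hβγ, hsum, hprod⟩ := hC1.gamma1_bounds hn hm0 hm1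
  have hm' : 0 < 1 - m := by linarith
  set γ₁ := gamma1 n m β
  set γ₂ := gamma2 n m β
  set C := Cstar n m with hCdef
  have hC : 0 < C := by rw [hCdef, Cstar]; positivity
  set k := 2 / (1 - m) with hk
  have hk0 : 0 < k := by positivity
  have hmk : m * k + 2 = k := by rw [hk]; field_simp; ring
  set F : ℝ → ℝ := fun r => f r ^ m with hF
  set c := C ^ (-(1 / (1 - m))) with hc
  have hc0 : 0 < c := rpow_pos_of_pos hC _
  set v : ℝ → ℝ := fun s => c * exp (k * s) * f (exp s) with hv
  set V : ℝ → ℝ := fun s => c ^ m * exp (m * k * s) * F (exp s) with hV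
  set V' : ℝ → ℝ := fun s =>
    c ^ m * exp (m * k * s) * (m * k * F (exp s) + exp s * deriv F (exp s)) with hV'
  have hveq : ∀ s, v s = (exp s ^ 2 / C) ^ (1 / (1 - m)) * f (exp s) := by
    intro s
    have : exp (k * s) = (exp s ^ 2) ^ (1 / (1 - m)) := by
      rw [← exp_nat_mul, ← exp_mul, hk]; congr 1; push_cast; ring
    simp only [hv]
    rw [div_rpow (by positivity) hC.le, hc, rpow_neg hC.le, this]
    ring
  have hvpos : ∀ s, 0 < v s := fun s =>
    mul_pos (mul_pos hc0 (exp_pos _)) (h.pos _ (exp_pos s).le)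
  have hVv : ∀ s, V s = v s ^ m := by
    intro s
    simp only [hv, hV, hF]
    rw [mul_rpow (by positivity) (h.pos _ (exp_pos s).le).le, mul_rpow hc0.le (exp_pos _).le,
      ← exp_mul]
    congr 3; ring
  have hexp : ∀ a s : ℝ, HasDerivAt (fun s => exp (a * s)) (exp (a * s) * a) s := fun a s => by
    simpa using ((hasDerivAt_id s).const_mul a).exp
  have hFexp : ∀ s, HasDerivAt (fun s => F (exp s)) (deriv F (exp s) * exp s) s := fun s =>
    (h.hasDerivAt_rpow (exp_pos s)).comp s (Real.hasDerivAt_exp s)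
  have hdV : ∀ s, HasDerivAt V (V' s) s := fun s => by
    refine (((hexp (m * k) s).const_mul (c ^ m)).mul (hFexp s)).congr_deriv ?_
    simp only [hV']
    ring
  have hdv : ∀ s, HasDerivAt v
      (c * exp (k * s) * (k * f (exp s) + exp s * deriv f (exp s))) s := fun s => by
    refine (((hexp k s).const_mul c).mul
      ((h.hasDerivAt (exp_pos s)).comp s (Real.hasDerivAt_exp s))).congr_deriv ?_
    simp only [Function.comp_apply]
    ring
  have hcC : c ^ m = C * c := by
    rw [hc, ← rpow_mul hC.le]
    nth_rewrite 2 [← rpow_one C]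
    rw [← rpow_add hC]
    congr 1; field_simp; ring
  have hdV' : ∀ s, HasDerivAt V'
      (-(((n : ℝ) - 2 - 2 * (m * k)) * V' s) - C * β *
        (c * exp (k * s) * (k * f (exp s) + exp s * deriv f (exp s)))
        - C / (1 - m) * (v s - V s)) s := fun s => by
    have h1 : HasDerivAt (fun s => exp s * deriv F (exp s))
        (exp s * deriv F (exp s) + exp s * (deriv (deriv F) (exp s) * exp s)) s :=
      (Real.hasDerivAt_exp s).mul
        ((h.hasDerivAt_deriv_rpow (exp_pos s)).comp s (Real.hasDerivAt_exp s))
    refine (((hexp (m * k) s).const_mul (c ^ m)).mul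
      (((hFexp s).const_mul (m * k)).add h1)).congr_deriv ?_
    have hode := h.ode (exp s) (exp_pos s)
    have hes : exp (k * s) = exp (m * k * s) * exp s ^ 2 := by
      rw [← exp_nat_mul, ← exp_add]; congr 1; push_cast; linear_combination -s * hmk
    have hαk : α = β * k + 1 / (1 - m) := by rw [hα, hk]; ring
    have hCm : C / (1 - m) = m * k * ((n : ℝ) - 2 - m * k) := by
      rw [hCdef, Cstar, hk]; field_simp; ring
    have hode' : exp s ^ 2 * deriv (deriv F) (exp s) + (n - 1) * exp s * deriv F (exp s) +
        exp s ^ 2 * (α * f (exp s) + β * exp s * deriv f (exp s)) = 0 := by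
      have : exp s ^ 2 * (((n : ℝ) - 1) / exp s) = (n - 1) * exp s := by
        field_simp
      linear_combination exp s ^ 2 * hode - deriv F (exp s) * this
    simp only [hv, hV, hV', Pi.add_apply]
    rw [hαk] at hode'
    rw [hes]
    linear_combination c ^ m * exp (m * k * s) * hode'
      - (c ^ m * exp (m * k * s)) * F (exp s) * hCm
      - (exp (m * k * s) * exp s ^ 2) * ((β * k + 1 / (1 - m)) * f (exp s) +
        β * exp s * deriv f (exp s)) * hcC
  have hf_bot : Tendsto (fun s => f (exp s)) atBot (𝓝 (f 0)) :=
    h.tendsto_nhdsGT_zero.comp tendsto_exp_atBot_nhdsGT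
  have hv_bot : Tendsto v atBot (𝓝 0) := by
    simpa using ((tendsto_exp_mul_atBot_of_pos hk0).const_mul c).mul hf_bot
  have hV'_bot : Tendsto V' atBot (𝓝 0) := by
    obtain ⟨d, hd⟩ := h.exists_tendsto_deriv_nhdsGT_zero
    have hf0 : f 0 ≠ 0 := (h.pos 0 le_rfl).ne'
    have hF1 : Tendsto (fun s => deriv F (exp s)) atBot (𝓝 (d * m * f 0 ^ (m - 1))) := by
      refine (((hd.comp tendsto_exp_atBot_nhdsGT).mul_const m).mul
        (hf_bot.rpow_const (p := m - 1) (Or.inl hf0))).congr fun s => ?_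
      exact ((h.hasDerivAt (exp_pos s)).rpow_const
        (Or.inl (h.pos _ (exp_pos s).le).ne')).deriv.symm
    have h1 := ((tendsto_exp_mul_atBot_of_pos (a := m * k) (by positivity)).const_mul (c ^ m)).mul
      (((hf_bot.rpow_const (p := m) (Or.inl hf0)).const_mul (m * k)).add
        (tendsto_exp_atBot.mul hF1))
    simpa using h1
  have hv_top : Tendsto v atTop (𝓝 1) := by
    have h1 := ((h.asymp.comp tendsto_exp_atTop).div_const C).rpow_const
      (p := 1 / (1 - m)) (Or.inr (by positivity))
    rw [← hCdef, div_self hC.ne', one_rpow] at h1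
    refine h1.congr fun s => ?_
    have hfs := h.pos _ (exp_pos s).le
    rw [hveq]
    simp only [Function.comp_apply]
    rw [mul_div_right_comm, mul_rpow (by positivity) (by positivity), ← rpow_mul hfs.le,
      mul_one_div_cancel hm'.ne', rpow_one]
  have hb : 0 ≤ C * β := by positivity
  have hκ : 0 < C / (1 - m) - C * β * γ₁ := by
    have := mul_lt_mul_of_pos_left hβγ hC
    have h2 : C * (1 / (1 - m)) = C / (1 - m) := by ring
    linarith
  have hsum' : γ₁ + γ₂ = (n : ℝ) - 2 - 2 * (m * k) + C * β / m := by
    rw [hsum, A0, hCdef, Cstar, hk]; field_simp; ring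
  have hprod' : γ₁ * γ₂ = C / (1 - m) / m - C / (1 - m) := by
    rw [hprod, hCdef, Cstar]; field_simp
  have hE : ∀ s, HasDerivAt
      (fun s => exp (γ₁ * s) * (V' s + γ₂ * (V s - 1) + C * β * (v s - 1 - (V s - 1) / m)))
      (-((C / (1 - m) - C * β * γ₁) * (exp (γ₁ * s) * (v s - 1 - (V s - 1) / m)))) s := by
    intro s
    refine ((hexp γ₁ s).mul (((hdV' s).add (((hdV s).sub_const 1).const_mul γ₂)).add
      ((((hdv s).sub_const 1).sub (((hdV s).sub_const 1).div_const m)).const_mul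
        (C * β)))).congr_deriv ?_
    simp only [Pi.add_apply, Pi.sub_apply]
    linear_combination exp (γ₁ * s) * V' s * hsum' + exp (γ₁ * s) * (V s - 1) * hprod'
  obtain ⟨B, hB, hlim⟩ := exists_tendsto_exp_mul_sub_one hm0 hm hγ₁ hγ hb hκ hvpos hVv hdV hE
    hv_bot hV'_bot hv_top
  exact ⟨B, hB, hlim.congr fun s => by rw [hveq]⟩

end IsProfile

/-- Second-order asymptotics of the self-similar profile at infinity, case (C1). -/
theorem second_order_asymptotics_C1 (n : ℕ) (m β α : ℝ) (hn : 3 ≤ n) (hm0 : 0 < m)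
    (hm1 : m < ((n : ℝ) - 2) / n) (hα : α = (2 * β + 1) / (1 - m)) (hC1 : CondC1 n m β)
    (f : ℝ → ℝ → ℝ) (hf : ∀ lam, 0 < lam → IsProfile n m β α lam (f lam))
    (hscale : ∀ lam, 0 < lam → ∀ r, 0 ≤ r → f lam r = lam ^ (2 / (1 - m)) * f 1 (lam * r)) :
    ∃ B : ℝ, 0 < B ∧ ∀ lam, 0 < lam →
      Tendsto
        (fun r : ℝ => r ^ gamma1 n m β * ((r ^ 2 / Cstar n m) ^ (1 / (1 - m)) * f lam r - 1))
        atTop (nhds (-(B * lam ^ (-gamma1 n m β)))) := by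
  obtain ⟨B, hB, hlim⟩ := (hf 1 one_pos).exists_tendsto_exp hn hm0 hm1 hα hC1
  obtain ⟨-, hm, hN, -⟩ := hC1.gamma1_bounds hn hm0 hm1
  have hm' : 0 < 1 - m := by linarith
  have hC : 0 < Cstar n m := by rw [Cstar]; positivity
  refine ⟨B, hB, fun lam hlam => ?_⟩
  have hlog : Tendsto (fun r => log (lam * r)) atTop atTop :=
    tendsto_log_atTop.comp (tendsto_id.const_mul_atTop hlam)
  have h := (hlim.comp hlog).const_mul (lam ^ (-gamma1 n m β))
  rw [mul_neg, mul_comm _ B] at h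
  refine h.congr' ?_
  filter_upwards [eventually_gt_atTop 0] with r hr
  have hlr : 0 < lam * r := mul_pos hlam hr
  have h1 : exp (gamma1 n m β * log (lam * r)) = lam ^ gamma1 n m β * r ^ gamma1 n m β := by
    rw [mul_comm (gamma1 n m β), ← rpow_def_of_pos hlr, mul_rpow hlam.le hr.le]
  have h2 : ((lam * r) ^ 2 / Cstar n m) ^ (1 / (1 - m)) =
      (r ^ 2 / Cstar n m) ^ (1 / (1 - m)) * lam ^ (2 / (1 - m)) := by
    rw [mul_pow, mul_div_assoc, mul_comm, mul_rpow (by positivity) (by positivity),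
      ← rpow_natCast lam 2, ← rpow_mul hlam.le]
    congr 2; push_cast; ring
  have h3 : lam ^ (-gamma1 n m β) * lam ^ gamma1 n m β = 1 := by
    rw [← rpow_add hlam, neg_add_cancel, rpow_zero]
  simp only [Function.comp_apply]
  rw [h1, exp_log hlr, h2, hscale lam hlam r hr.le]
  linear_combination (r ^ gamma1 n m β * ((r ^ 2 / Cstar n m) ^ (1 / (1 - m)) *
    (lam ^ (2 / (1 - m)) * f 1 (lam * r)) - 1)) * h3
end

section
/- Suppose condition (C3) holds. Then γ_2(m,β_1(m)) = 2, and there exists a constant B > 0 such that for every λ > 0 the self-similar profile f_λ satisfies lim_{r→∞} r² ( (r²/C_*)^{1/(1-m)} f_λ(r) − 1 ) = − B λ^{−2}; moreover in this case f_λ(r) = (C_*/(k² + r²))^{1/(1-m)} for all r ≥ 0, where k = √(C_*)/λ. -/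
open Real Filter MeasureTheory Set Topology

theorem eq_zero_value_of_hasDerivAt_zero {F : ℝ → ℝ} (hc : ContinuousOn F (Ici 0))
    (hd : ∀ r, 0 < r → HasDerivAt F 0 r) {r : ℝ} (hr : 0 ≤ r) : F r = F 0 := by
  rcases hr.eq_or_lt with rfl | hr
  · rfl
  obtain ⟨c, -, hcs⟩ := exists_hasDerivAt_eq_slope F (fun _ => 0) hr
    (hc.mono Icc_subset_Ici_self) (fun x hx => hd x hx.1)
  have h : F r - F 0 = 0 := by
    rcases div_eq_zero_iff.1 hcs.symm with h | h
    · exact h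
    · linarith
  linarith

theorem sub_two_sub_mul_pos {n : ℕ} {m : ℝ} (hn : 3 ≤ n) (hm1 : m < ((n : ℝ) - 2) / n) :
    0 < (n : ℝ) - 2 - n * m := by
  have hn' : (0 : ℝ) < n := by exact_mod_cast (by omega : 0 < n)
  rw [lt_div_iff₀ hn'] at hm1
  linarith

theorem lt_one_of_lt_sub_two_div {n : ℕ} {m : ℝ} (hn : 3 ≤ n) (hm1 : m < ((n : ℝ) - 2) / n) :
    m < 1 := by
  have hn' : (0 : ℝ) < n := by exact_mod_cast (by omega : 0 < n)
  refine hm1.trans ?_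
  rw [div_lt_one hn']
  linarith

theorem Cstar_pos {n : ℕ} {m : ℝ} (hm0 : 0 < m) (hm : m < 1) (ha : 0 < (n : ℝ) - 2 - n * m) :
    0 < Cstar n m := by
  have : 0 < 1 - m := by linarith
  unfold Cstar
  positivity

theorem gamma2_beta1_eq_two {n : ℕ} {m β : ℝ} (hn : 3 ≤ n) (hm0 : 0 < m)
    (hm1 : m < ((n : ℝ) - 2) / n) (hC3 : CondC3 n m β) : gamma2 n m (beta1 n m) = 2 := by
  have ha := sub_two_sub_mul_pos hn hm1
  have hm : 0 < 1 - m := sub_pos.2 (lt_one_of_lt_sub_two_div hn hm1)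
  have hn3 : (3 : ℝ) ≤ n := by exact_mod_cast hn
  have hle : (n : ℝ) - 2 - n * m ≤ 2 * (1 - m) := by
    rcases hC3.2 with h | ⟨-, h, -⟩
    · have hn4 : (n : ℝ) ≤ 4 := by exact_mod_cast h
      nlinarith [mul_nonneg (by linarith : (0 : ℝ) ≤ n - 2) hm0.le]
    · rw [div_lt_iff₀ (by linarith)] at h
      linarith
  have hA : A0 n m (beta1 n m) = (n : ℝ) - 2 - n * m + 2 * (1 - m) := by
    unfold A0 beta1
    field_simp
    ring
  have hdisc : ((n : ℝ) - 2 - n * m + 2 * (1 - m)) ^ 2 - 8 * ((n : ℝ) - 2 - n * m) * (1 - m)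
      = (2 * (1 - m) - ((n : ℝ) - 2 - n * m)) ^ 2 := by ring
  rw [gamma2, hA, hdisc, Real.sqrt_sq (by linarith)]
  field_simp
  ring

/-- When `α = n β`, the profile equation is in divergence form and integrates once. -/
theorem IsProfile.first_integral {n : ℕ} {m β α lam : ℝ} {f : ℝ → ℝ} (hn : 2 ≤ n)
    (hf : IsProfile n m β α lam f) (hα : α = n * β) {r : ℝ} (hr : 0 < r) :
    deriv (fun s => f s ^ m) r = -(β * r * f r) := by
  obtain ⟨k, rfl⟩ : ∃ k, n = k + 2 := ⟨n - 2, by omega⟩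
  set g : ℝ → ℝ := fun s => f s ^ m with hg
  have hgC : ContDiffOn ℝ 2 g (Ici 0) :=
    hf.smooth.rpow_const_of_ne fun x hx => (hf.pos x hx).ne'
  have hnhds : ∀ {x : ℝ}, 0 < x → Ici (0 : ℝ) ∈ 𝓝 x := fun hx => Ici_mem_nhds hx
  set G : ℝ → ℝ := derivWithin g (Ici 0) with hG
  have hGC : ContDiffOn ℝ 1 G (Ici 0) :=
    hgC.derivWithin (uniqueDiffOn_Ici 0) (by norm_num)
  have hGg : ∀ {x : ℝ}, 0 < x → G x = deriv g x := fun hx => derivWithin_of_mem_nhds (hnhds hx)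
  have hGd : ∀ x : ℝ, 0 < x → HasDerivAt G (deriv (deriv g) x) x := by
    intro x hx
    have h1 : DifferentiableAt ℝ G x :=
      (hGC.contDiffAt (hnhds hx)).differentiableAt one_ne_zero
    have h2 : G =ᶠ[𝓝 x] deriv g := by
      filter_upwards [Ioi_mem_nhds hx] with y hy using hGg hy
    rw [← h2.deriv_eq]
    exact h1.hasDerivAt
  have hfd : ∀ x : ℝ, 0 < x → HasDerivAt f (deriv f x) x := fun x hx =>
    ((hf.smooth.contDiffAt (hnhds hx)).differentiableAt two_ne_zero).hasDerivAt
  have hconst := eq_zero_value_of_hasDerivAt_zero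
    (F := fun x => x ^ (k + 1) * G x + β * (x ^ (k + 2) * f x))
    (((continuousOn_pow _).mul hGC.continuousOn).add
      (continuousOn_const.mul ((continuousOn_pow _).mul hf.smooth.continuousOn)))
    (fun x hx => by
      have hd := ((hasDerivAt_pow (k + 1) x).mul (hGd x hx)).add
        (((hasDerivAt_pow (k + 2) x).mul (hfd x hx)).const_mul β)
      refine hd.congr_deriv ?_
      have hode := hf.ode x hx
      rw [← hg, hα] at hode
      have hode' : x ^ (k + 1) * (deriv (deriv g) x + (((k + 2 : ℕ) : ℝ) - 1) / x * deriv g x +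
          ((k + 2 : ℕ) : ℝ) * β * f x + β * x * deriv f x) = 0 := by
        rw [hode, mul_zero]
      have hx0 := hx.ne'
      rw [hGg hx, ← hode']
      push_cast
      field_simp
      ring) hr.le
  simp only [hGg hr, ne_eq, Nat.add_eq_zero_iff, one_ne_zero, OfNat.ofNat_ne_zero, and_false,
    not_false_eq_true, zero_pow, zero_mul, mul_zero, add_zero] at hconst
  have hmul : r ^ (k + 1) * (deriv g r + β * r * f r) = 0 := by
    rw [← hconst]
    ring
  have := (mul_eq_zero.1 hmul).resolve_left (pow_pos hr _).ne'
  linarith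

theorem IsProfile.rpow_sub_one_eq {n : ℕ} {m lam α : ℝ} {f : ℝ → ℝ} (hn : 2 ≤ n) (hm0 : 0 < m)
    (hm : m < 1) (ha : 0 < (n : ℝ) - 2 - n * m) (hlam : 0 < lam)
    (hf : IsProfile n m (beta1 n m) α lam f) (hα : α = n * beta1 n m) {r : ℝ} (hr : 0 ≤ r) :
    f r ^ (m - 1) = (lam ^ 2)⁻¹ + r ^ 2 / Cstar n m := by
  have hm' : 0 < 1 - m := by linarith
  have hconst := eq_zero_value_of_hasDerivAt_zero
    (F := fun x => f x ^ (m - 1) - x ^ 2 / Cstar n m)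
    ((hf.smooth.continuousOn.rpow_const fun x hx => Or.inl (hf.pos x hx).ne').sub
      ((continuousOn_pow _).div_const _))
    (fun x hx => by
      have hfx := hf.pos x hx.le
      have hfd : HasDerivAt f (deriv f x) x :=
        ((hf.smooth.contDiffAt (Ici_mem_nhds hx)).differentiableAt two_ne_zero).hasDerivAt
      have hfi := hf.first_integral hn hα hx
      rw [(hfd.rpow_const (Or.inl hfx.ne')).deriv] at hfi
      have hd := (hfd.rpow_const (p := m - 1) (Or.inl hfx.ne')).sub
        ((hasDerivAt_pow 2 x).div_const (Cstar n m))
      refine hd.congr_deriv ?_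
      have hpow : f x ^ (m - 1) = f x ^ (m - 1 - 1) * f x := by
        rw [← Real.rpow_add_one hfx.ne', sub_add_cancel]
      rw [hpow] at hfi
      have hkey : deriv f x * m * f x ^ (m - 1 - 1) = -(beta1 n m * x) := by
        apply mul_right_cancel₀ hfx.ne'
        linarith
      have hkey' : deriv f x * (m - 1) * f x ^ (m - 1 - 1)
          = -(beta1 n m * x) * ((m - 1) / m) := by
        rw [← hkey]
        field_simp
      rw [hkey']
      unfold beta1 Cstar
      field_simp
      ring) hr
  have h0 : f 0 ^ (m - 1) = (lam ^ 2)⁻¹ := by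
    rw [hf.init, ← Real.rpow_mul hlam.le,
      show 2 / (1 - m) * (m - 1) = -(2 : ℝ) by field_simp; ring, Real.rpow_neg hlam.le,
      Real.rpow_two]
  simp only [h0] at hconst
  norm_num at hconst
  linarith

theorem IsProfile.eq_barenblatt {n : ℕ} {m lam α : ℝ} {f : ℝ → ℝ} (hn : 2 ≤ n) (hm0 : 0 < m)
    (hm : m < 1) (ha : 0 < (n : ℝ) - 2 - n * m) (hlam : 0 < lam)
    (hf : IsProfile n m (beta1 n m) α lam f) (hα : α = n * beta1 n m) {r : ℝ} (hr : 0 ≤ r) :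
    f r = (Cstar n m / ((Real.sqrt (Cstar n m) / lam) ^ 2 + r ^ 2)) ^ (1 / (1 - m)) := by
  have hm' : 0 < 1 - m := by linarith
  have hC := Cstar_pos hm0 hm ha
  have hfr := hf.pos r hr
  have hbase : Cstar n m / ((Real.sqrt (Cstar n m) / lam) ^ 2 + r ^ 2) = f r ^ (1 - m) := by
    rw [← neg_sub m 1, Real.rpow_neg hfr.le, hf.rpow_sub_one_eq hn hm0 hm ha hlam hα hr, div_pow,
      Real.sq_sqrt hC.le]
    field_simp
  rw [hbase, ← Real.rpow_mul hfr.le, mul_one_div_cancel hm'.ne', Real.rpow_one]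

theorem tendsto_sq_mul_rpow_sub_one (K p : ℝ) :
    Tendsto (fun r : ℝ => r ^ 2 * ((1 + K * (r ^ 2)⁻¹) ^ p - 1)) atTop (𝓝 (K * p)) := by
  have hd : HasDerivAt (fun x : ℝ => (1 + K * x) ^ p) (K * p) 0 := by
    have h1 : HasDerivAt (fun x : ℝ => 1 + K * x) K 0 := by
      simpa using ((hasDerivAt_id (0 : ℝ)).const_mul K).const_add 1
    simpa using h1.rpow_const (p := p) (Or.inl (by simp))
  have hlim : Tendsto (fun r : ℝ => (r ^ 2)⁻¹) atTop (𝓝[≠] 0) :=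
    ((tendsto_inv_atTop_nhdsGT_zero (𝕜 := ℝ)).comp (tendsto_pow_atTop two_ne_zero)).mono_right
      (nhdsWithin_mono _ fun x hx => ne_of_gt hx)
  refine ((hasDerivAt_iff_tendsto_slope.1 hd).comp hlim).congr fun r => ?_
  simp [slope_def_field, div_eq_mul_inv, mul_comm]

/-- Second-order asymptotics of the self-similar profile at infinity, case (C3):
`γ₂(m,β₁(m)) = 2`, the second-order limit holds with `γ = 2`, and the profile is the
rescaled Barenblatt profile. -/
theorem second_order_asymptotics_C3 (n : ℕ) (m β α : ℝ) (hn : 3 ≤ n) (hm0 : 0 < m)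
    (hm1 : m < ((n : ℝ) - 2) / n) (hα : α = (2 * β + 1) / (1 - m)) (hC3 : CondC3 n m β)
    (f : ℝ → ℝ → ℝ) (hf : ∀ lam, 0 < lam → IsProfile n m β α lam (f lam))
    (hscale : ∀ lam, 0 < lam → ∀ r, 0 ≤ r → f lam r = lam ^ (2 / (1 - m)) * f 1 (lam * r)) :
    gamma2 n m (beta1 n m) = 2 ∧
    ∃ B : ℝ, 0 < B ∧ ∀ lam, 0 < lam →
      (Tendsto
        (fun r : ℝ => r ^ 2 * ((r ^ 2 / Cstar n m) ^ (1 / (1 - m)) * f lam r - 1))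
        atTop (nhds (-(B * lam ^ ((-2 : ℝ))))) ∧
      ∀ r, 0 ≤ r →
        f lam r = (Cstar n m / ((Real.sqrt (Cstar n m) / lam) ^ 2 + r ^ 2)) ^ (1 / (1 - m))) := by
  have ha := sub_two_sub_mul_pos hn hm1
  have hm : m < 1 := lt_one_of_lt_sub_two_div hn hm1
  have hm' : 0 < 1 - m := sub_pos.2 hm
  have hC := Cstar_pos hm0 hm ha
  refine ⟨gamma2_beta1_eq_two hn hm0 hm1 hC3, Cstar n m * (1 / (1 - m)), by positivity, ?_⟩
  intro lam hlam
  obtain rfl := hC3.1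
  have hα' : α = n * beta1 n m := by
    rw [hα]
    unfold beta1
    field_simp
    ring
  have hB : ∀ r, 0 ≤ r →
      f lam r = (Cstar n m / ((Real.sqrt (Cstar n m) / lam) ^ 2 + r ^ 2)) ^ (1 / (1 - m)) :=
    fun r hr => (hf lam hlam).eq_barenblatt (by omega) hm0 hm ha hlam hα' hr
  refine ⟨?_, hB⟩
  have hlim := tendsto_sq_mul_rpow_sub_one (Cstar n m / lam ^ 2) (-(1 / (1 - m)))
  have hval : Cstar n m / lam ^ 2 * -(1 / (1 - m))
      = -(Cstar n m * (1 / (1 - m)) * lam ^ (-2 : ℝ)) := by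
    rw [Real.rpow_neg hlam.le, Real.rpow_two]
    ring
  rw [hval] at hlim
  refine hlim.congr' ?_
  filter_upwards [eventually_gt_atTop 0] with r hr
  rw [hB r hr.le, ← Real.mul_rpow (by positivity) (by positivity), Real.rpow_neg (by positivity),
    ← Real.inv_rpow (by positivity), div_pow, Real.sq_sqrt hC.le]
  congr 3
  field_simp
  ring
end
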